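/- Let G be a finitely generated group of super-linear growth in which, for every ε > 0 and r > 0, there exists an (ε,r)-Følner set (i.e. G is amenable), and let (X,μ,T) be a free ergodic G-system. Let U ⊆ X be measurable with μ(U) > 0, and let ε > 0. Then there is a nontrivial orbit-wise connected T-graphing Γ = (A_g)_{g ∈ G} such that Vert(Γ) ⊆ U, μ(Vert(Γ)) < ε, and the |·|_G-cost satisfies Σ_{g ∈ G} |g|_G · μ(A_g) < ε. -/

import Mathlib

open MeasureTheory Filter
open scoped ENNReal Pointwise

/-- The word length of `g` with respect to the generating set `S`. -/
noncomputable def wordLength {G : Type*} [Group G] (S : Set G) (g : G) : ℕ :=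
  sInf {n | ∃ l : List G, l.length = n ∧ (∀ s ∈ l, s ∈ S) ∧ l.prod = g}

/-- The ball `B_G(r) = {g : |g|_G ≤ r}`. -/
def wordBall {G : Type*} [Group G] (S : Set G) (r : ℝ) : Set G :=
  {g : G | (wordLength S g : ℝ) ≤ r}

section PathEdges

open scoped Classical

variable {α : Type*}

/-- The pairs of consecutive entries of a list, in both orders. -/
noncomputable def List.pathEdges : List α → Finset (α × α)
  | a :: b :: l => {(a, b), (b, a)} ∪ List.pathEdges (b :: l)
  | _ => ∅

lemma List.mem_of_mem_pathEdges {l : List α} {e : α × α} (he : e ∈ List.pathEdges l) :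
    e.1 ∈ l ∧ e.2 ∈ l := by
  induction l with
  | nil => simp [List.pathEdges] at he
  | cons a t ih =>
    cases t with
    | nil => simp [List.pathEdges] at he
    | cons b t =>
      simp only [List.pathEdges, Finset.mem_union, Finset.mem_insert, Finset.mem_singleton] at he
      rcases he with (rfl | rfl) | he
      · simp
      · simp
      · exact ⟨List.mem_cons_of_mem _ (ih he).1, List.mem_cons_of_mem _ (ih he).2⟩

lemma List.swap_mem_pathEdges {l : List α} {a b : α} (he : (a, b) ∈ List.pathEdges l) :
    (b, a) ∈ List.pathEdges l := by
  induction l with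
  | nil => simp [List.pathEdges] at he
  | cons c t ih =>
    cases t with
    | nil => simp [List.pathEdges] at he
    | cons d t =>
      simp only [List.pathEdges, Finset.mem_union, Finset.mem_insert, Finset.mem_singleton,
        Prod.mk.injEq] at he ⊢
      rcases he with he | he
      · tauto
      · exact Or.inr (ih he)

lemma List.joined_of_mem_pathEdges {l : List α} {a b : α} (ha : a ∈ l) (hb : b ∈ l) :
    Relation.ReflTransGen (fun x y => (x, y) ∈ List.pathEdges l) a b := by
  induction l generalizing a b with
  | nil => simp at ha
  | cons c t ih =>
    cases t with
    | nil =>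
      obtain rfl : a = c := by simpa using ha
      obtain rfl : b = a := by simpa using hb
      exact .refl
    | cons d t =>
      have hmono : ∀ x y, (x, y) ∈ List.pathEdges (d :: t) → (x, y) ∈ List.pathEdges (c :: d :: t) :=
        fun x y h => by simp [List.pathEdges, h]
      have hcd : (c, d) ∈ List.pathEdges (c :: d :: t) := by simp [List.pathEdges]
      have hdc : (d, c) ∈ List.pathEdges (c :: d :: t) := by simp [List.pathEdges]
      have key : ∀ {x y}, x ∈ d :: t → y ∈ d :: t →
          Relation.ReflTransGen (fun x y => (x, y) ∈ List.pathEdges (c :: d :: t)) x y :=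
        fun hx hy => Relation.ReflTransGen.mono hmono _ _ (ih hx hy)
      rcases List.mem_cons.1 ha with rfl | ha' <;> rcases List.mem_cons.1 hb with rfl | hb'
      · exact .refl
      · exact Relation.ReflTransGen.head hcd (key (by simp) hb')
      · exact Relation.ReflTransGen.tail (key ha' (by simp)) hdc
      · exact key ha' hb'

end PathEdges

/-- A proper length function on a group all of whose elements are reached from the identity
by steps of length at most one. -/
structure GeodesicLength (G : Type*) [Group G] where
  /-- The length of an element. -/
  len : G → ℕ
  len_one : len 1 = 0
  len_mul_le : ∀ g h, len (g * h) ≤ len g + len h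
  len_inv : ∀ g, len g⁻¹ = len g
  exists_of_len_succ : ∀ n g, len g = n + 1 → ∃ s h, len s ≤ 1 ∧ len h = n ∧ g = s * h
  finite_len_le : ∀ n, {g | len g ≤ n}.Finite

namespace GeodesicLength

open scoped Classical

variable {G : Type*} [Group G] (ℓ : GeodesicLength G)

/-- The closed ball of radius `n` around the identity. -/
noncomputable def ball (n : ℕ) : Finset G := (ℓ.finite_len_le n).toFinset

@[simp] lemma mem_ball {n : ℕ} {g : G} : g ∈ ℓ.ball n ↔ ℓ.len g ≤ n := by simp [ball]

lemma ball_mono {m n : ℕ} (h : m ≤ n) : ℓ.ball m ⊆ ℓ.ball n := fun g hg => by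
  rw [mem_ball] at *; omega

lemma one_mem_ball (n : ℕ) : (1 : G) ∈ ℓ.ball n := by simp [ℓ.len_one]

lemma inv_mem_ball {n : ℕ} {g : G} (hg : g ∈ ℓ.ball n) : g⁻¹ ∈ ℓ.ball n := by
  simpa [ℓ.len_inv] using hg

/-- The right-invariant distance associated with a length function. -/
def gap (a b : G) : ℕ := ℓ.len (b * a⁻¹)

@[simp] lemma gap_self (a : G) : ℓ.gap a a = 0 := by simp [gap, ℓ.len_one]

lemma gap_comm (a b : G) : ℓ.gap a b = ℓ.gap b a := by
  rw [gap, gap, ← ℓ.len_inv]; simp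

lemma gap_triangle (a b c : G) : ℓ.gap a c ≤ ℓ.gap a b + ℓ.gap b c := by
  have := ℓ.len_mul_le (c * b⁻¹) (b * a⁻¹)
  simp only [gap]
  have h : c * b⁻¹ * (b * a⁻¹) = c * a⁻¹ := by group
  rw [h] at this; omega

/-- The total length of the path visiting the entries of a list in order. -/
def pathLen : List G → ℕ
  | a :: b :: l => ℓ.gap a b + pathLen (b :: l)
  | _ => 0

lemma pathLen_cons_le (a c : G) (l : List G) :
    ℓ.pathLen (a :: l) ≤ ℓ.gap a c + ℓ.pathLen (c :: l) := by
  cases l with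
  | nil => simp [pathLen]
  | cons b t =>
    have := ℓ.gap_triangle a c b
    simp only [pathLen]; omega

lemma pathLen_le_cons (a : G) (l : List G) : ℓ.pathLen l ≤ ℓ.pathLen (a :: l) := by
  cases l with
  | nil => simp [pathLen]
  | cons b t => simp only [pathLen]; omega

lemma pathLen_cons_sublist {l₁ l₂ : List G} (h : l₁.Sublist l₂) (a : G) :
    ℓ.pathLen (a :: l₁) ≤ ℓ.pathLen (a :: l₂) := by
  induction h generalizing a with
  | slnil => exact le_rfl
  | cons c _ ih =>
    refine (ℓ.pathLen_cons_le a c _).trans ?_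
    have := ih c
    simp only [pathLen]; omega
  | cons_cons c _ ih =>
    have := ih c
    simp only [pathLen]; omega

lemma pathLen_sublist {l₁ l₂ : List G} (h : l₁.Sublist l₂) : ℓ.pathLen l₁ ≤ ℓ.pathLen l₂ := by
  cases h with
  | slnil => exact le_rfl
  | cons c h =>
    exact ((ℓ.pathLen_le_cons c _).trans (ℓ.pathLen_cons_sublist h c))
  | cons_cons c h => exact ℓ.pathLen_cons_sublist h c

lemma exists_insert_cons (a b c : G) (l : List G) (ha : a ∈ c :: l) :
    ∃ l', (∀ x, x ∈ l' ↔ x = b ∨ x ∈ l) ∧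
      ℓ.pathLen (c :: l') ≤ ℓ.pathLen (c :: l) + 2 * ℓ.gap a b := by
  induction l generalizing c with
  | nil =>
    obtain rfl : a = c := by simpa using ha
    exact ⟨[b], by simp, by simp only [pathLen]; omega⟩
  | cons d t ih =>
    rcases List.mem_cons.1 ha with rfl | ha
    · refine ⟨b :: d :: t, by simp, ?_⟩
      have := ℓ.pathLen_cons_le b a (d :: t)
      have h := ℓ.gap_comm a b
      simp only [pathLen] at *; omega
    · obtain ⟨l', h1, h2⟩ := ih d ha
      refine ⟨d :: l', fun x => ?_, by simp only [pathLen] at *; omega⟩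
      simp only [List.mem_cons, h1]; tauto

lemma exists_insert {a b : G} {l : List G} (ha : a ∈ l) :
    ∃ l', (∀ x, x ∈ l' ↔ x = b ∨ x ∈ l) ∧ ℓ.pathLen l' ≤ ℓ.pathLen l + 2 * ℓ.gap a b := by
  cases l with
  | nil => simp at ha
  | cons c t =>
    obtain ⟨l', h1, h2⟩ := ℓ.exists_insert_cons a b c t ha
    refine ⟨c :: l', fun x => ?_, h2⟩
    simp only [List.mem_cons, h1]; tauto

/-- A finite set that cannot be split without cutting a step of length at most one. -/
def Connected (C : Finset G) : Prop :=
  ∀ A ⊆ C, A.Nonempty → A ≠ C → ∃ a ∈ A, ∃ s, ℓ.len s ≤ 1 ∧ s * a ∈ C ∧ s * a ∉ A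

variable {ℓ} in
lemma Connected.exists_net {C : Finset G} (hC : ℓ.Connected C) (hne : C.Nonempty) (r : ℕ) :
    ∃ N ⊆ C, ∃ l : List G, (∀ x, x ∈ l ↔ x ∈ N) ∧ ℓ.pathLen l ≤ 2 * (r + 1) * N.card ∧
      (∀ a ∈ N, ∀ b ∈ N, a ≠ b → r < ℓ.gap a b) ∧ ∀ c ∈ C, ∃ a ∈ N, ℓ.gap a c ≤ r := by
  set p : Finset G → Prop := fun N => N.Nonempty ∧
    (∃ l : List G, (∀ x, x ∈ l ↔ x ∈ N) ∧ ℓ.pathLen l ≤ 2 * (r + 1) * N.card) ∧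
      (∀ a ∈ N, ∀ b ∈ N, a ≠ b → r < ℓ.gap a b) with hp
  obtain ⟨c₀, hc₀⟩ := hne
  obtain ⟨N, hN, hmax⟩ := Finset.exists_max_image (C.powerset.filter p) Finset.card
    ⟨{c₀}, by
      simp only [Finset.mem_filter, Finset.mem_powerset, Finset.singleton_subset_iff, hc₀, hp,
        true_and]
      refine ⟨by simp, ⟨[c₀], by simp, by simp [pathLen]⟩, ?_⟩
      intro a ha b hb hab
      simp_all⟩
  simp only [Finset.mem_filter, Finset.mem_powerset] at hN hmax
  obtain ⟨hNC, hNne, ⟨l, hl, hlen⟩, hsep⟩ := hN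
  refine ⟨N, hNC, l, hl, hlen, hsep, ?_⟩
  by_contra! hcon
  obtain ⟨c, hcC, hc⟩ := hcon
  obtain ⟨a, ha, s, hs, hsC, hsA⟩ := hC (C.filter fun c => ∃ a ∈ N, ℓ.gap a c ≤ r)
    (Finset.filter_subset _ _)
    (by
      obtain ⟨n, hn⟩ := hNne
      exact ⟨n, Finset.mem_filter.2 ⟨hNC hn, n, hn, by simp⟩⟩)
    (by
      intro h
      rw [← h, Finset.mem_filter] at hcC
      obtain ⟨-, a, ha, hle⟩ := hcC
      exact absurd (hc a ha) (by omega))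
  simp only [Finset.mem_filter, not_and, not_exists, not_le, hsC, true_implies] at ha hsA
  obtain ⟨-, n, hn, hna⟩ := ha
  have hsn : s * a ∉ N := fun h => by simpa using hsA _ h
  have hgap : ℓ.gap n (s * a) ≤ r + 1 := by
    have h1 := ℓ.gap_triangle n a (s * a)
    have h2 : ℓ.gap a (s * a) = ℓ.len s := by simp [gap]
    omega
  obtain ⟨l', hl', hlen'⟩ := ℓ.exists_insert (b := s * a) ((hl n).2 hn)
  have := hmax (insert (s * a) N) ⟨Finset.insert_subset hsC hNC, by simp,
    ⟨l', fun x => by simp [hl', hl], by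
      rw [Finset.card_insert_of_notMem hsn]
      nlinarith⟩, by
      intro x hx y hy hxy
      rcases Finset.mem_insert.1 hx with rfl | hx <;> rcases Finset.mem_insert.1 hy with rfl | hy
      · exact absurd rfl hxy
      · rw [gap_comm]; exact hsA _ hy
      · exact hsA _ hx
      · exact hsep x hx y hy hxy⟩
  rw [Finset.card_insert_of_notMem hsn] at this
  omega

lemma exists_tour {C N W : Finset G} {r : ℕ} {l : List G} (hl : ∀ x, x ∈ l ↔ x ∈ N)
    (hnet : ∀ c ∈ C, ∃ a ∈ N, ℓ.gap a c ≤ r) (hW : W ⊆ C) :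
    ∃ l' : List G, (∀ x, x ∈ l' ↔ x ∈ W) ∧ ℓ.pathLen l' ≤ ℓ.pathLen l + 2 * r * W.card := by
  obtain ⟨l', hl', hlen⟩ : ∃ l' : List G, (∀ x, x ∈ l' ↔ x ∈ N ∨ x ∈ W) ∧
      ℓ.pathLen l' ≤ ℓ.pathLen l + 2 * r * W.card := by
    induction W using Finset.induction_on with
    | empty => exact ⟨l, by simpa using hl, by simp⟩
    | insert w W hw ih =>
      obtain ⟨l', h1, h2⟩ := ih ((Finset.subset_insert _ _).trans hW)
      obtain ⟨a, ha, hle⟩ := hnet w (hW (Finset.mem_insert_self _ _))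
      obtain ⟨l'', h3, h4⟩ := ℓ.exists_insert (b := w) ((h1 a).2 (Or.inl ha))
      refine ⟨l'', fun x => ?_, ?_⟩
      · rw [h3, h1, Finset.mem_insert]; tauto
      · rw [Finset.card_insert_of_notMem hw]
        nlinarith
  refine ⟨l'.filter (· ∈ W), fun x => ?_, (ℓ.pathLen_sublist List.filter_sublist).trans hlen⟩
  simp only [List.mem_filter, hl', decide_eq_true_eq]; tauto

lemma sum_pathEdges_le (l : List G) :
    ∑ e ∈ l.pathEdges, ℓ.gap e.1 e.2 ≤ 2 * ℓ.pathLen l := by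
  induction l with
  | nil => simp [List.pathEdges]
  | cons a t ih =>
    cases t with
    | nil => simp [List.pathEdges]
    | cons b t =>
      simp only [List.pathEdges, pathLen]
      have h0 := Finset.sum_union_inter (s₁ := ({(a, b), (b, a)} : Finset (G × G)))
        (s₂ := List.pathEdges (b :: t)) (f := fun e => ℓ.gap e.1 e.2)
      have h : ∑ e ∈ ({(a, b), (b, a)} : Finset (G × G)), ℓ.gap e.1 e.2 ≤
          ℓ.gap a b + ℓ.gap b a := by
        rw [Finset.insert_eq]
        have h1 := Finset.sum_union_inter (s₁ := ({(a, b)} : Finset (G × G)))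
          (s₂ := {(b, a)}) (f := fun e => ℓ.gap e.1 e.2)
        simp only [Finset.sum_singleton] at h1
        omega
      rw [ℓ.gap_comm b a] at h
      omega

/-- The points of `D` at which the translate of `K` is not contained in `D`. -/
noncomputable def _root_.Finset.frontierBy (K D : Finset G) : Finset G :=
  D.filter fun d => ¬ ∀ k ∈ K, k * d ∈ D

lemma _root_.Finset.frontierBy_subset (K D : Finset G) : K.frontierBy D ⊆ D :=
  Finset.filter_subset _ _

lemma card_mul_le_of_separated {ρ R : ℕ} (hρ : ρ ≤ R) {N D : Finset G} (hN : N ⊆ D)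
    (hsep : ∀ a ∈ N, ∀ b ∈ N, a ≠ b → 2 * ρ < ℓ.gap a b) :
    (ℓ.ball ρ).card * N.card ≤
      (ℓ.ball ρ).card * ((ℓ.ball R).frontierBy D).card + D.card := by
  set I := N.filter fun d => ∀ k ∈ ℓ.ball R, k * d ∈ D with hI
  have h1 : N.card ≤ ((ℓ.ball R).frontierBy D).card + I.card := by
    rw [← Finset.card_filter_add_card_filter_not (s := N) (fun d => ∀ k ∈ ℓ.ball R, k * d ∈ D),
      add_comm]
    exact Nat.add_le_add_right (Finset.card_le_card (Finset.filter_subset_filter _ hN)) _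
  have h2 : (ℓ.ball ρ).card * I.card ≤ D.card := by
    rw [← Finset.card_product]
    refine Finset.card_le_card_of_injOn (fun x => x.1 * x.2) ?_ ?_
    · rintro ⟨k, n⟩ h
      simp only [Finset.coe_product, Set.mem_prod, Finset.mem_coe, hI, Finset.mem_filter] at h
      exact h.2.2 k (ℓ.ball_mono hρ h.1)
    · rintro ⟨k, n⟩ h ⟨k', n'⟩ h' heq
      simp only [Finset.coe_product, Set.mem_prod, Finset.mem_coe, hI, Finset.mem_filter,
        mem_ball] at h h' heq
      have hn : n = n' := by
        by_contra hne
        have h3 := hsep n h.2.1 n' h'.2.1 hne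
        have h4 : n' * n⁻¹ = k'⁻¹ * k := by
          rw [mul_inv_eq_iff_eq_mul, mul_assoc, heq, inv_mul_cancel_left]
        have h5 := ℓ.len_mul_le k'⁻¹ k
        rw [ℓ.len_inv] at h5
        rw [gap, h4] at h3
        omega
      subst hn
      simpa using heq
  nlinarith

lemma exists_connected_piece {D : Finset G} (hD : D.Nonempty) :
    ∃ C ⊆ D, C.Nonempty ∧ ℓ.Connected C ∧
      ∀ c ∈ C, ∀ s, ℓ.len s ≤ 1 → s * c ∈ D → s * c ∈ C := by
  obtain ⟨C, hC, hmin⟩ := Finset.exists_min_image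
    (D.powerset.filter fun C => C.Nonempty ∧ ∀ c ∈ C, ∀ s, ℓ.len s ≤ 1 → s * c ∈ D → s * c ∈ C)
    Finset.card ⟨D, by simp [hD]⟩
  simp only [Finset.mem_filter, Finset.mem_powerset] at hC hmin
  obtain ⟨hCD, hne, hcl⟩ := hC
  refine ⟨C, hCD, hne, ?_, hcl⟩
  intro A hA hAne hAC
  by_contra! hcon
  have := hmin A ⟨hA.trans hCD, hAne, fun a ha s hs hsa =>
    hcon a ha s hs (hcl a (hA ha) s hs hsa)⟩
  exact hAC (Finset.eq_of_subset_of_card_le hA this)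

lemma ball_mul_mem {C D : Finset G}
    (hcl : ∀ c ∈ C, ∀ s, ℓ.len s ≤ 1 → s * c ∈ D → s * c ∈ C) {R : ℕ} {c : G} (hc : c ∈ C)
    (hint : ∀ k ∈ ℓ.ball R, k * c ∈ D) {k : G} (hk : k ∈ ℓ.ball R) : k * c ∈ C := by
  obtain ⟨n, hn⟩ : ∃ n, ℓ.len k = n := ⟨_, rfl⟩
  induction n using Nat.strong_induction_on generalizing k with
  | _ n ih =>
    rcases n with _ | n
    · have := hcl c hc k (by omega) (hint k hk)
      exact this
    · obtain ⟨s, h, hs, hh, rfl⟩ := ℓ.exists_of_len_succ n k hn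
      have hhR : h ∈ ℓ.ball R := by rw [mem_ball] at *; omega
      rw [mul_assoc]
      refine hcl _ (ih n (by omega) hhR hh) s hs ?_
      rw [← mul_assoc]
      exact hint _ hk

/-- Inside a finite set `D`, the points of `W` can be joined along few short edges, up to
representatives `Z`, so that points close to the interior of `D` end up joined. -/
theorem exists_forest {ρ R : ℕ} (hρ : ρ ≤ R) (D W : Finset G) (hW : W ⊆ D) :
    ∃ (E : Finset (G × G)) (Z : Finset G) (m : ℕ),
      (∀ a b, (a, b) ∈ E → (b, a) ∈ E) ∧ (∀ e ∈ E, e.1 ∈ W ∧ e.2 ∈ W) ∧ Z ⊆ W ∧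
      ∑ e ∈ E, ℓ.gap e.1 e.2 ≤ 4 * (2 * ρ + 1) * m + 8 * ρ * W.card ∧
      (ℓ.ball ρ).card * m ≤ (ℓ.ball ρ).card * ((ℓ.ball R).frontierBy D).card + D.card ∧
      (ℓ.ball R).card * Z.card ≤
        (ℓ.ball R).card * ((ℓ.ball R).frontierBy D).card + D.card ∧
      (∀ w ∈ W, ∃ z ∈ Z, Relation.ReflTransGen (fun x y => (x, y) ∈ E) w z) ∧
      ∀ d ∈ D, (∀ k ∈ ℓ.ball R, k * d ∈ D) → ∀ g ∈ ℓ.ball R, ∀ h ∈ ℓ.ball R,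
        g * d ∈ W → h * d ∈ W →
        Relation.ReflTransGen (fun x y => (x, y) ∈ E) (g * d) (h * d) := by
  obtain ⟨n, hn⟩ : ∃ n, D.card = n := ⟨_, rfl⟩
  induction n using Nat.strong_induction_on generalizing D W with
  | _ n ih =>
  rcases D.eq_empty_or_nonempty with rfl | hD
  · obtain rfl : W = ∅ := Finset.subset_empty.1 hW
    exact ⟨∅, ∅, 0, by simp, by simp, by simp, by simp, by simp, by simp, by simp, by simp⟩
  obtain ⟨C, hCD, hCne, hconn, hcl⟩ := ℓ.exists_connected_piece hD
  have hcard : (D \ C).card + C.card = D.card := Finset.card_sdiff_add_card_eq_card hCD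
  have hCpos := hCne.card_pos
  have hcl' : ∀ c ∈ D \ C, ∀ s, ℓ.len s ≤ 1 → s * c ∈ D → s * c ∈ D \ C := by
    intro c hc s hs hsc
    rw [Finset.mem_sdiff] at hc ⊢
    refine ⟨hsc, fun h => hc.2 ?_⟩
    have := hcl _ h s⁻¹ (by rwa [ℓ.len_inv]) (by simpa using hc.1)
    simpa using this
  have hball : ∀ {d}, d ∈ C → (∀ k ∈ ℓ.ball R, k * d ∈ D) → ∀ k ∈ ℓ.ball R, k * d ∈ C :=
    fun hd hint k hk => ℓ.ball_mul_mem hcl hd hint hk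
  have hball' : ∀ {d}, d ∈ D \ C → (∀ k ∈ ℓ.ball R, k * d ∈ D) → ∀ k ∈ ℓ.ball R,
      k * d ∈ D \ C :=
    fun hd hint k hk => ℓ.ball_mul_mem hcl' hd hint hk
  have hfr : ((ℓ.ball R).frontierBy (D \ C)).card + ((ℓ.ball R).frontierBy C).card ≤
      ((ℓ.ball R).frontierBy D).card := by
    rw [← Finset.card_union_of_disjoint]
    · refine Finset.card_le_card ?_
      intro d hd
      simp only [Finset.frontierBy, Finset.mem_union, Finset.mem_filter] at hd ⊢
      rcases hd with ⟨h1, h2⟩ | ⟨h1, h2⟩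
      · exact ⟨Finset.sdiff_subset h1, fun h => h2 (hball' h1 h)⟩
      · exact ⟨hCD h1, fun h => h2 (hball h1 h)⟩
    · exact Finset.disjoint_of_subset_left (Finset.filter_subset _ _)
        (Finset.disjoint_of_subset_right (Finset.filter_subset _ _) Finset.sdiff_disjoint)
  obtain ⟨E, Z, m, hE1, hE2, hZ, hcost, hm, hZc, hrep, hjoin⟩ :=
    ih (D \ C).card (by omega) (D \ C) (W \ C) (Finset.sdiff_subset_sdiff hW le_rfl) rfl
  obtain ⟨N, hNC, l₀, hl₀, hlen₀, hsep, hnet⟩ := hconn.exists_net hCne (2 * ρ)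
  obtain ⟨l, hl, hlen⟩ := ℓ.exists_tour hl₀ hnet (W := W ∩ C) Finset.inter_subset_right
  have hNcard := ℓ.card_mul_le_of_separated hρ hNC hsep
  obtain ⟨Z', hZ', hZ'c, hrep'⟩ : ∃ Z' ⊆ W ∩ C, (ℓ.ball R).card * Z'.card ≤
      (ℓ.ball R).card * ((ℓ.ball R).frontierBy C).card + C.card ∧
      ∀ w ∈ W ∩ C, ∃ z ∈ Z', Relation.ReflTransGen (fun x y => (x, y) ∈ l.pathEdges) w z := by
    rcases (W ∩ C).eq_empty_or_nonempty with h | ⟨w, hw⟩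
    · exact ⟨∅, by simp, by simp, by simp [h]⟩
    · refine ⟨{w}, by simpa using hw, ?_, fun x hx => ⟨w, by simp,
        List.joined_of_mem_pathEdges ((hl x).2 hx) ((hl w).2 hw)⟩⟩
      refine ℓ.card_mul_le_of_separated le_rfl
        (by simpa using (Finset.mem_inter.1 hw).2) ?_
      intro a ha b hb hab
      simp_all
  have hWcard : (W \ C).card + (W ∩ C).card = W.card := Finset.card_sdiff_add_card_inter _ _
  have hl1 : ∀ {x y}, Relation.ReflTransGen (fun x y => (x, y) ∈ l.pathEdges) x y →
      Relation.ReflTransGen (fun x y => (x, y) ∈ E ∪ l.pathEdges) x y := fun h =>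
    Relation.ReflTransGen.mono (fun x y hxy => Finset.mem_union_right _ hxy) _ _ h
  have hl2 : ∀ {x y}, Relation.ReflTransGen (fun x y => (x, y) ∈ E) x y →
      Relation.ReflTransGen (fun x y => (x, y) ∈ E ∪ l.pathEdges) x y := fun h =>
    Relation.ReflTransGen.mono (fun x y hxy => Finset.mem_union_left _ hxy) _ _ h
  refine ⟨E ∪ l.pathEdges, Z ∪ Z', m + N.card, ?_, ?_, ?_, ?_, ?_, ?_, ?_, ?_⟩
  · intro a b h
    rcases Finset.mem_union.1 h with h | h
    · exact Finset.mem_union_left _ (hE1 a b h)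
    · exact Finset.mem_union_right _ (List.swap_mem_pathEdges h)
  · intro e h
    rcases Finset.mem_union.1 h with h | h
    · exact ⟨Finset.sdiff_subset (hE2 e h).1, Finset.sdiff_subset (hE2 e h).2⟩
    · have := List.mem_of_mem_pathEdges h
      rw [hl, hl] at this
      exact ⟨Finset.inter_subset_left this.1, Finset.inter_subset_left this.2⟩
  · exact Finset.union_subset (hZ.trans Finset.sdiff_subset) (hZ'.trans Finset.inter_subset_left)
  · have h0 := Finset.sum_union_inter (s₁ := E) (s₂ := l.pathEdges) (f := fun e => ℓ.gap e.1 e.2)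
    have h1 := ℓ.sum_pathEdges_le l
    have h2 : ∑ e ∈ E ∪ l.pathEdges, ℓ.gap e.1 e.2 ≤
        ∑ e ∈ E, ℓ.gap e.1 e.2 + ∑ e ∈ l.pathEdges, ℓ.gap e.1 e.2 := by omega
    rw [← hWcard]
    linarith
  · have h1 := Nat.mul_le_mul_left (ℓ.ball ρ).card hfr
    rw [mul_add] at h1 ⊢
    omega
  · have h0 := Nat.mul_le_mul_left (ℓ.ball R).card (Finset.card_union_le Z Z')
    have h1 := Nat.mul_le_mul_left (ℓ.ball R).card hfr
    rw [mul_add] at h0 h1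
    omega
  · intro w hw
    by_cases hwC : w ∈ C
    · obtain ⟨z, hz, h⟩ := hrep' w (Finset.mem_inter.2 ⟨hw, hwC⟩)
      exact ⟨z, Finset.mem_union_right _ hz, hl1 h⟩
    · obtain ⟨z, hz, h⟩ := hrep w (Finset.mem_sdiff.2 ⟨hw, hwC⟩)
      exact ⟨z, Finset.mem_union_left _ hz, hl2 h⟩
  · intro d hd hint g hg h hh hgW hhW
    by_cases hdC : d ∈ C
    · have hb := hball hdC hint
      exact hl1 (List.joined_of_mem_pathEdges ((hl _).2 (Finset.mem_inter.2 ⟨hgW, hb g hg⟩))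
        ((hl _).2 (Finset.mem_inter.2 ⟨hhW, hb h hh⟩)))
    · have hd' : d ∈ D \ C := Finset.mem_sdiff.2 ⟨hd, hdC⟩
      have hb := hball' hd' hint
      exact hl2 (hjoin d hd' hb g hg h hh
        (Finset.mem_sdiff.2 ⟨hgW, (Finset.mem_sdiff.1 (hb g hg)).2⟩)
        (Finset.mem_sdiff.2 ⟨hhW, (Finset.mem_sdiff.1 (hb h hh)).2⟩))

end GeodesicLength

section Tilings

open scoped Classical

variable {G X : Type*} [Group G] [MeasurableSpace X] [MulAction G X]

lemma measurableSet_trace_eq [MeasurableConstSMul G X] {V : Set X} (hV : MeasurableSet V)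
    (D W : Finset G) : MeasurableSet {x : X | ∀ d ∈ D, d • x ∈ V ↔ d ∈ W} := by
  have : {x : X | ∀ d ∈ D, d • x ∈ V ↔ d ∈ W} = ⋂ d ∈ D, {x | d • x ∈ V ↔ d ∈ W} := by
    ext; simp
  rw [this]
  refine Finset.measurableSet_biInter _ fun d _ => ?_
  exact MeasurableSet.iff (measurable_const_smul d hV) (MeasurableSet.const _)

/-- A family of pairwise disjoint finite pieces of orbits, of finitely supported shapes
attached to measurable sets of base points. -/
structure TileFamily (G X ι : Type*) [Group G] [MeasurableSpace X] [MulAction G X] where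
  /-- The base points of the tiles with a given index. -/
  base : ι → Set X
  /-- The shape of the tiles with a given index. -/
  shape : ι → Finset G
  measurableSet_base : ∀ i, MeasurableSet (base i)
  eq_of_smul_eq : ∀ i j, ∀ g ∈ shape i, ∀ h ∈ shape j, ∀ x ∈ base i, ∀ y ∈ base j,
    g • x = h • y → i = j ∧ g = h

namespace TileFamily

variable {ι : Type*} (𝒯 : TileFamily G X ι)

/-- The union of the parts of the tiles selected by `E`. -/
def region (E : ι → Finset G) : Set X := ⋃ i, ⋃ g ∈ E i, g • 𝒯.base i

lemma mem_region {E : ι → Finset G} {x : X} :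
    x ∈ 𝒯.region E ↔ ∃ i, ∃ g ∈ E i, ∃ y ∈ 𝒯.base i, g • y = x := by
  simp [region, Set.mem_smul_set]

variable [MeasurableConstSMul G X] [Countable ι]

lemma measurableSet_region (E : ι → Finset G) : MeasurableSet (𝒯.region E) :=
  MeasurableSet.iUnion fun i => Finset.measurableSet_biUnion _ fun g _ =>
    (𝒯.measurableSet_base i).const_smul g

variable (μ : Measure X) [SMulInvariantMeasure G X μ]

omit [MeasurableConstSMul G X] in
lemma measure_region_le (E : ι → Finset G) :
    μ (𝒯.region E) ≤ ∑' i, ((E i).card : ℝ≥0∞) * μ (𝒯.base i) := by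
  refine (measure_iUnion_le _).trans (ENNReal.tsum_le_tsum fun i => ?_)
  refine (measure_biUnion_finset_le _ _).trans ?_
  simp [measure_smul]

lemma measure_region {E : ι → Finset G} (hE : ∀ i, E i ⊆ 𝒯.shape i) :
    μ (𝒯.region E) = ∑' i, ((E i).card : ℝ≥0∞) * μ (𝒯.base i) := by
  rw [region, measure_iUnion]
  · refine tsum_congr fun i => ?_
    rw [measure_biUnion_finset]
    · simp [measure_smul]
    · intro g hg h hh hgh
      refine Set.disjoint_left.2 ?_
      rintro _ ⟨x, hx, rfl⟩ ⟨y, hy, hxy⟩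
      exact hgh (𝒯.eq_of_smul_eq i i g (hE i hg) h (hE i hh) x hx y hy hxy.symm).2
    · exact fun g _ => (𝒯.measurableSet_base i).const_smul g
  · intro i j hij
    refine Set.disjoint_left.2 fun z hz hz' => ?_
    simp only [Set.mem_iUnion, Set.mem_smul_set] at hz hz'
    obtain ⟨g, hg, x, hx, rfl⟩ := hz
    obtain ⟨h, hh, y, hy, hxy⟩ := hz'
    exact hij (𝒯.eq_of_smul_eq i j g (hE i hg) h (hE j hh) x hx y hy hxy.symm).1
  · exact fun i => Finset.measurableSet_biUnion _ fun g _ =>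
      (𝒯.measurableSet_base i).const_smul g

omit [Countable ι] in
/-- Tiles can be subdivided according to their trace on a measurable set. -/
lemma exists_refinement {V : Set X} (hV : MeasurableSet V) :
    ∃ 𝒯' : TileFamily G X (ι × Finset G), (∀ j, 𝒯'.shape j = 𝒯.shape j.1) ∧
      (∀ j, ∀ x ∈ 𝒯'.base j, ∀ d ∈ 𝒯.shape j.1, d • x ∈ V ↔ d ∈ j.2) ∧
      ∀ E : ι → Finset G, 𝒯'.region (fun j => E j.1) = 𝒯.region E := by
  refine ⟨⟨fun j => {x | x ∈ 𝒯.base j.1 ∧ j.2 ⊆ 𝒯.shape j.1 ∧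
      ∀ d ∈ 𝒯.shape j.1, d • x ∈ V ↔ d ∈ j.2}, fun j => 𝒯.shape j.1, ?_, ?_⟩, fun _ => rfl,
    fun j x hx => hx.2.2, ?_⟩
  · intro j
    refine (𝒯.measurableSet_base j.1).inter ((MeasurableSet.const _).inter ?_)
    exact measurableSet_trace_eq hV _ _
  · rintro ⟨i, A⟩ ⟨j, B⟩ g hg h hh x ⟨hx, hA, hxA⟩ y ⟨hy, hB, hyB⟩ hxy
    obtain ⟨rfl, rfl⟩ := 𝒯.eq_of_smul_eq i j g hg h hh x hx y hy hxy
    obtain rfl : x = y := smul_left_cancel g hxy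
    refine ⟨Prod.ext rfl (Finset.ext fun d => ?_), rfl⟩
    constructor
    · intro hd
      exact (hyB d (hA hd)).1 ((hxA d (hA hd)).2 hd)
    · intro hd
      exact (hxA d (hB hd)).1 ((hyB d (hB hd)).2 hd)
  · intro E
    ext z
    simp only [mem_region]
    constructor
    · rintro ⟨j, g, hg, y, hy, rfl⟩
      exact ⟨j.1, g, hg, y, hy.1, rfl⟩
    · rintro ⟨i, g, hg, y, hy, rfl⟩
      refine ⟨(i, (𝒯.shape i).filter fun d => d • y ∈ V), g, hg, y, ⟨hy, ?_, ?_⟩, rfl⟩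
      · exact Finset.filter_subset _ _
      · intro d hd
        simp [hd]

end TileFamily

lemma exists_separated_cover [StandardBorelSpace X] [MeasurableConstSMul G X] (Δ : Finset G) :
    ∃ C : ℕ → Set X, (∀ n, MeasurableSet (C n)) ∧
      (∀ n, ∀ g ∈ Δ, g ≠ 1 → ∀ x ∈ C n, g • x ∉ C n) ∧
      ∀ x, (∀ g : G, g • x = x → g = 1) → ∃ n, x ∈ C n := by
  obtain ⟨φ, hφ⟩ := exists_measurableEmbedding_real X
  set D : ℚ × ℚ → Set X := fun q => {x | φ x ∈ Set.Ioo (q.1 : ℝ) q.2 ∧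
    ∀ g ∈ Δ, g ≠ 1 → φ (g • x) ∉ Set.Ioo (q.1 : ℝ) q.2} with hD
  obtain ⟨e, he⟩ := exists_surjective_nat (ℚ × ℚ)
  refine ⟨fun n => D (e n), fun n => ?_, ?_, ?_⟩
  · refine (hφ.measurable measurableSet_Ioo).inter ?_
    have : {x | ∀ g ∈ Δ, g ≠ 1 → φ (g • x) ∉ Set.Ioo ((e n).1 : ℝ) (e n).2} =
        ⋂ g ∈ Δ, {x | g ≠ 1 → φ (g • x) ∉ Set.Ioo ((e n).1 : ℝ) (e n).2} := by
      ext; simp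
    change MeasurableSet {x | ∀ g ∈ Δ, g ≠ 1 → φ (g • x) ∉ Set.Ioo ((e n).1 : ℝ) (e n).2}
    rw [this]
    refine Finset.measurableSet_biInter _ fun g _ => ?_
    refine MeasurableSet.imp (MeasurableSet.const _) ?_
    exact ((hφ.measurable.comp (measurable_const_smul g)) measurableSet_Ioo).compl
  · rintro n g hg hg1 x hx hgx
    exact hx.2 g hg hg1 hgx.1
  · intro x hx
    set O : Set ℝ := (((Δ.filter fun g => g ≠ 1).image fun g => φ (g • x) : Finset ℝ) : Set ℝ)ᶜ
    have hO : IsOpen O := (Finset.finite_toSet _).isClosed.isOpen_compl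
    have hxO : φ x ∈ O := by
      simp only [O, Set.mem_compl_iff, Finset.mem_coe, Finset.mem_image, Finset.mem_filter]
      rintro ⟨g, ⟨-, hg⟩, h⟩
      exact hg (hx g (hφ.injective h))
    obtain ⟨s, hs, hxs, hsO⟩ := Real.isTopologicalBasis_Ioo_rat.exists_subset_of_mem_open hxO hO
    simp only [Set.mem_iUnion, Set.mem_singleton_iff] at hs
    obtain ⟨a, b, -, rfl⟩ := hs
    obtain ⟨n, hn⟩ := he (a, b)
    refine ⟨n, ?_⟩
    simp only [hn, hD]
    refine ⟨hxs, fun g hg hg1 h => ?_⟩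
    have := hsO h
    simp only [O, Set.mem_compl_iff, Finset.mem_coe, Finset.mem_image, Finset.mem_filter] at this
    exact this ⟨g, ⟨hg, hg1⟩, rfl⟩

/-- If `G` has Følner sets, then almost all of the space can be partitioned into tiles of
uniformly bounded shape whose `K`-frontiers have small total measure. -/
theorem exists_tiling [StandardBorelSpace X] [MeasurableConstSMul G X] [Countable G]
    (μ : Measure X) [IsProbabilityMeasure μ] [SMulInvariantMeasure G X μ]
    (hfree : ∀ᵐ x ∂μ, ∀ g : G, g • x = x → g = 1)
    {K : Finset G} (hK : ∀ k ∈ K, k⁻¹ ∈ K)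
    (hFol : ∀ q : ℕ, ∃ F : Finset G, F.Nonempty ∧ q * ((K * F) \ F).card ≤ F.card)
    {η : ℝ≥0∞} (hη : η ≠ 0) :
    ∃ (𝒯 : TileFamily G X (ℕ × Finset G)) (F : Finset G), (∀ i, 𝒯.shape i ⊆ F) ∧
      μ (𝒯.region 𝒯.shape)ᶜ = 0 ∧
      μ (𝒯.region fun i => K.frontierBy (𝒯.shape i)) ≤ η := by
  obtain ⟨q, hq⟩ : ∃ q : ℕ, ((insert 1 K).card : ℝ≥0∞) / q ≤ η ∧ q ≠ 0 := by
    obtain ⟨n, hn⟩ := ENNReal.exists_nat_mul_gt hη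
      (ENNReal.natCast_ne_top (insert (1 : G) K).card)
    refine ⟨n, ?_, ?_⟩
    · exact ENNReal.div_le_of_le_mul' hn.le
    · rintro rfl
      simp at hn
  obtain ⟨hqη, hq0⟩ := hq
  obtain ⟨F, hF, hFq⟩ := hFol (2 * q)
  set M : Finset G := F ∪ K * F with hM
  have hMF : M \ F = (K * F) \ F := by rw [hM, Finset.union_sdiff_left]
  obtain ⟨C, hCmeas, hCsep, hCcov⟩ := exists_separated_cover (X := X) (F⁻¹ * F)
  set good : Finset G → Prop := fun B => B ⊆ M ∧ q * (B \ F).card ≤ (B ∩ F).card with hgood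
  set c : ℕ → ℕ := fun n => n.unpair.1 with hc
  set P : ℕ → Set X → Finset G → Set X := fun n Y B =>
    {x | x ∈ C (c n) ∧ good B ∧ ∀ g ∈ M, g • x ∈ Y ↔ g ∈ B} with hP
  have hPmeas : ∀ n Y B, MeasurableSet Y → MeasurableSet (P n Y B) := fun n Y B hY =>
    (hCmeas _).inter ((MeasurableSet.const _).inter (measurableSet_trace_eq hY _ _))
  set step : ℕ → Set X → Set X := fun n Y => Y \ ⋃ B, ⋃ g ∈ B ∩ F, g • P n Y B with hstep
  set Y : ℕ → Set X := fun n => Nat.rec Set.univ step n with hY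
  have hY0 : Y 0 = Set.univ := rfl
  have hYs : ∀ n, Y (n + 1) = step n (Y n) := fun n => rfl
  have hYmeas : ∀ n, MeasurableSet (Y n) := by
    intro n
    induction n with
    | zero => exact MeasurableSet.univ
    | succ n ih =>
      rw [hYs]
      exact ih.diff (MeasurableSet.iUnion fun B => Finset.measurableSet_biUnion _ fun g _ =>
        (hPmeas n _ B ih).const_smul g)
  have hYanti : Antitone Y := antitone_nat_of_succ_le fun n => by
    rw [hYs]; exact Set.sdiff_subset
  have hnotin : ∀ {n B g x}, g ∈ B ∩ F → x ∈ P n (Y n) B → g • x ∉ Y (n + 1) := by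
    intro n B g x hg hx h
    rw [hYs] at h
    refine h.2 ?_
    simp only [Set.mem_iUnion]
    exact ⟨B, g, hg, Set.smul_mem_smul_set hx⟩
  have hin : ∀ {n B g x}, g ∈ B → x ∈ P n (Y n) B → g • x ∈ Y n := by
    intro n B g x hg hx
    exact (hx.2.2 g (hx.2.1.1 hg)).2 hg
  have hout : ∀ {n z}, z ∉ Y n → ∃ m < n, ∃ B, ∃ g ∈ B ∩ F, ∃ x ∈ P m (Y m) B, g • x = z := by
    intro n z hz
    induction n with
    | zero => exact absurd (Set.mem_univ z) hz
    | succ n ih =>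
      by_cases hzn : z ∈ Y n
      · rw [hYs] at hz
        simp only [hstep, Set.mem_sdiff, hzn, true_and, not_not, Set.mem_iUnion,
          Set.mem_smul_set] at hz
        obtain ⟨B, g, hg, x, hx, hxz⟩ := hz
        exact ⟨n, by omega, B, g, hg, x, hx, hxz⟩
      · obtain ⟨m, hm, h⟩ := ih hzn
        exact ⟨m, by omega, h⟩
  let 𝒯 : TileFamily G X (ℕ × Finset G) :=
    { base := fun i => P i.1 (Y i.1) i.2
      shape := fun i => i.2 ∩ F
      measurableSet_base := fun i => hPmeas _ _ _ (hYmeas _)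
      eq_of_smul_eq := by
        rintro ⟨n, A⟩ ⟨m, B⟩ g hg h hh x hx y hy hxy
        dsimp only at hg hh hx hy
        have hnm : n = m := by
          rcases lt_trichotomy n m with hlt | heq | hlt
          · exact absurd (hYanti hlt (hin (Finset.mem_inter.1 hh).1 hy))
              (hxy ▸ hnotin hg hx)
          · exact heq
          · exact absurd (hYanti hlt (hin (Finset.mem_inter.1 hg).1 hx))
              (hxy ▸ hnotin hh hy)
        subst hnm
        have hgh : g = h := by
          by_contra hne
          have h1 : (h⁻¹ * g) • x = y := by rw [mul_smul, hxy, inv_smul_smul]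
          refine hCsep _ (h⁻¹ * g) (Finset.mul_mem_mul (Finset.inv_mem_inv
            (Finset.mem_inter.1 hh).2) (Finset.mem_inter.1 hg).2) ?_ x hx.1 (h1 ▸ hy.1)
          intro h2
          exact hne (inv_mul_eq_one.1 h2).symm
        subst hgh
        obtain rfl : x = y := smul_left_cancel g hxy
        refine ⟨Prod.ext rfl (Finset.ext fun d => ?_), rfl⟩
        exact ⟨fun hd => (hy.2.2 d (hx.2.1.1 hd)).1 (hin hd hx),
          fun hd => (hx.2.2 d (hy.2.1.1 hd)).1 (hin hd hy)⟩ }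
  have hcover : (𝒯.region 𝒯.shape)ᶜ = ⋂ n, Y n := by
    ext z
    rw [Set.mem_compl_iff, 𝒯.mem_region, Set.mem_iInter]
    constructor
    · intro h n
      by_contra hz
      obtain ⟨m, -, B, g, hg, x, hx, rfl⟩ := hout hz
      exact h ⟨(m, B), g, hg, x, hx, rfl⟩
    · rintro h ⟨⟨n, B⟩, g, hg, x, hx, rfl⟩
      exact hnotin hg hx (h (n + 1))
  refine ⟨𝒯, F, fun i => Finset.inter_subset_right, ?_, ?_⟩
  · rw [hcover]
    set Z := ⋂ n, Y n with hZ
    have hZmeas : MeasurableSet Z := MeasurableSet.iInter hYmeas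
    have hbad : ∀ x, (∀ g : G, g • x = x → g = 1) →
        (F.filter fun g => g • x ∈ Z).card ≤
          q * ((M \ F).filter fun g => g • x ∈ Z).card := by
      intro x hx
      by_contra! hlt
      obtain ⟨k, hk⟩ := hCcov x hx
      set B := M.filter fun g => g • x ∈ Z with hB
      have hBF : B ∩ F = F.filter fun g => g • x ∈ Z := by
        ext g; simp only [hB, hM, Finset.mem_inter, Finset.mem_filter, Finset.mem_union]; tauto
      have hBM : B \ F = (M \ F).filter fun g => g • x ∈ Z := by
        ext g; simp only [hB, Finset.mem_sdiff, Finset.mem_filter]; tauto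
      have hgB : good B := ⟨Finset.filter_subset _ _, by rw [hBF, hBM]; exact hlt.le⟩
      have hev : ∀ g : G, ∃ N, ∀ n ≥ N, g • x ∈ Y n ↔ g • x ∈ Z := by
        intro g
        by_cases hg : g • x ∈ Z
        · exact ⟨0, fun n _ => ⟨fun _ => hg, fun _ => Set.mem_iInter.1 hg n⟩⟩
        · obtain ⟨N, hN⟩ : ∃ N, g • x ∉ Y N := by simpa [hZ] using hg
          exact ⟨N, fun n hn => ⟨fun h => absurd (hYanti hn h) hN, fun h => absurd h hg⟩⟩
      choose N hN using hev
      set n := Nat.pair k (M.sup N) with hn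
      have hxP : x ∈ P n (Y n) B := by
        refine ⟨by simpa [hc, hn] using hk, hgB, fun g hg => ?_⟩
        rw [hN g n ((Finset.le_sup hg).trans (Nat.right_le_pair _ _))]
        simp [hB, hg]
      obtain ⟨g, hg⟩ : (B ∩ F).Nonempty := by
        rw [← Finset.card_pos, hBF]; omega
      refine hnotin hg hxP ?_
      have : g • x ∈ Z := by
        rw [hBF, Finset.mem_filter] at hg
        exact hg.2
      exact Set.mem_iInter.1 this (n + 1)
    have hint : ∀ E : Finset G, ∫⁻ x, ((E.filter fun g => g • x ∈ Z).card : ℝ≥0∞) ∂μ =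
        E.card * μ Z := by
      intro E
      have h1 : ∀ x, ((E.filter fun g => g • x ∈ Z).card : ℝ≥0∞) =
          ∑ g ∈ E, ((g • ·) ⁻¹' Z).indicator 1 x := by
        intro x
        rw [Finset.card_filter]
        push_cast
        refine Finset.sum_congr rfl fun g _ => ?_
        simp [Set.indicator_apply]
      simp_rw [h1]
      rw [lintegral_finsetSum _ fun g _ =>
        measurable_one.indicator (measurable_const_smul g hZmeas)]
      simp_rw [lintegral_indicator_one (measurable_const_smul _ hZmeas), measure_preimage_smul]
      simp
    have hle : (F.card : ℝ≥0∞) * μ Z ≤ q * (((M \ F).card : ℝ≥0∞) * μ Z) := by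
      rw [← hint, ← hint, ← lintegral_const_mul' _ _ (ENNReal.natCast_ne_top q)]
      refine lintegral_mono_ae ?_
      filter_upwards [hfree] with x hx
      exact_mod_cast hbad x hx
    have hfin : μ Z ≠ ∞ := measure_ne_top _ _
    have hle' : (F.card : ℝ) * μ.real Z ≤ q * ((M \ F).card * μ.real Z) := by
      have := ENNReal.toReal_mono (by finiteness) hle
      simpa [Measure.real] using this
    have hFq' : (2 * q * (M \ F).card : ℝ) ≤ F.card := by rw [hMF]; exact_mod_cast hFq
    have hFpos : (0 : ℝ) < F.card := by exact_mod_cast hF.card_pos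
    have h0 : (0 : ℝ) ≤ μ.real Z := measureReal_nonneg
    have : μ.real Z = 0 := by
      by_contra hne
      have hpos : 0 < μ.real Z := lt_of_le_of_ne h0 (Ne.symm hne)
      nlinarith [mul_le_mul_of_nonneg_right hFq' h0, mul_pos hFpos hpos]
    exact (measureReal_eq_zero_iff).1 this
  · have hsub : 𝒯.region (fun i => K.frontierBy (𝒯.shape i)) ⊆
        𝒯.region fun i => (insert 1 K) * (i.2 \ F) := by
      intro y hy
      rw [TileFamily.mem_region] at hy ⊢
      obtain ⟨⟨n, B⟩, d, hd, p, hp, rfl⟩ := hy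
      simp only [Finset.frontierBy, Finset.mem_filter, not_forall] at hd
      obtain ⟨hd, k, hk, hkd⟩ := hd
      have hdF : d ∈ F := (Finset.mem_inter.1 hd).2
      by_cases hkY : (k * d) • p ∈ Y n
      · have hkM : k * d ∈ M := Finset.mem_union_right _ (Finset.mul_mem_mul hk hdF)
        have hkB : k * d ∈ B := (hp.2.2 _ hkM).1 hkY
        have hkF : k * d ∉ F := fun h => hkd (Finset.mem_inter.2 ⟨hkB, h⟩)
        refine ⟨(n, B), k⁻¹ * (k * d), Finset.mul_mem_mul
          (Finset.mem_insert_of_mem (hK k hk)) (Finset.mem_sdiff.2 ⟨hkB, hkF⟩), p, hp, ?_⟩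
        rw [inv_mul_cancel_left]
      · obtain ⟨m, hm, A, g, hg, p', hp', heq⟩ := hout hkY
        have hdY : d • p ∈ Y (m + 1) := hYanti hm (hin (Finset.mem_inter.1 hd).1 hp)
        have heq' : (k⁻¹ * g) • p' = d • p := by
          rw [mul_smul, heq, mul_smul, inv_smul_smul]
        have hkM : k⁻¹ * g ∈ M := Finset.mem_union_right _
          (Finset.mul_mem_mul (hK k hk) (Finset.mem_inter.1 hg).2)
        have hkA : k⁻¹ * g ∈ A := (hp'.2.2 _ hkM).1 (by
          rw [heq']; exact hYanti (Nat.le_succ m) hdY)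
        have hkF : k⁻¹ * g ∉ F := fun h =>
          hnotin (Finset.mem_inter.2 ⟨hkA, h⟩) hp' (heq' ▸ hdY)
        exact ⟨(m, A), 1 * (k⁻¹ * g), Finset.mul_mem_mul (Finset.mem_insert_self _ _)
          (Finset.mem_sdiff.2 ⟨hkA, hkF⟩), p', hp', by rw [one_mul, heq']⟩
    refine (measure_mono hsub).trans ((𝒯.measure_region_le μ _).trans (le_trans ?_ hqη))
    have htot : ∑' i, ((𝒯.shape i).card : ℝ≥0∞) * μ (𝒯.base i) ≤ 1 := by
      rw [← 𝒯.measure_region μ fun _ => subset_rfl]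
      exact prob_le_one
    have hterm : ∀ i, (((insert 1 K) * (i.2 \ F)).card : ℝ≥0∞) * μ (𝒯.base i) ≤
        ((insert 1 K).card / q) * (((𝒯.shape i).card : ℝ≥0∞) * μ (𝒯.base i)) := by
      intro i
      rcases (𝒯.base i).eq_empty_or_nonempty with h | ⟨x, hx⟩
      · simp [h]
      · rw [← mul_assoc]
        gcongr
        have h1 : (((insert 1 K) * (i.2 \ F)).card : ℝ≥0∞) ≤
            (insert 1 K).card * (i.2 \ F).card := by exact_mod_cast Finset.card_mul_le
        have h2 : (q : ℝ≥0∞) * (i.2 \ F).card ≤ (𝒯.shape i).card := by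
          exact_mod_cast hx.2.1.2
        refine h1.trans ?_
        rw [div_eq_mul_inv, mul_assoc]
        gcongr
        rw [mul_comm, ← div_eq_mul_inv]
        rw [ENNReal.le_div_iff_mul_le (by simp [hq0]) (by simp), mul_comm]
        exact h2
    refine (ENNReal.tsum_le_tsum hterm).trans ?_
    rw [ENNReal.tsum_mul_left]
    exact mul_le_of_le_one_right' htot

/-- Two points joined by a path in the graphing `A`. -/
def GraphingJoined (A : G → Set X) : X → X → Prop :=
  Relation.ReflTransGen fun x y => ∃ g : G, x ∈ A g ∧ g • x = y

omit [MeasurableSpace X] in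
lemma GraphingJoined.mono {A B : G → Set X} (h : ∀ g, A g ⊆ B g) {x y : X}
    (hxy : GraphingJoined A x y) : GraphingJoined B x y :=
  Relation.ReflTransGen.mono (fun _ _ ⟨g, hg, he⟩ => ⟨g, h g hg, he⟩) _ _ hxy

omit [MeasurableSpace X] in
lemma GraphingJoined.symm {A : G → Set X} (hA : ∀ g, A g⁻¹ = (g⁻¹ • ·) ⁻¹' A g) {x y : X}
    (hxy : GraphingJoined A x y) : GraphingJoined A y x := by
  induction hxy with
  | refl => exact .refl
  | tail _ h ih =>
    obtain ⟨g, hg, rfl⟩ := h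
    exact ih.head ⟨g⁻¹, by rw [hA]; simpa using hg, by simp⟩

/-- A measurable set can be thinned out to a very sparse subset, to whose points all its points
are joined by a graphing whose cost is small as soon as the initial set is sparse. -/
theorem exists_thinning [StandardBorelSpace X] [MeasurableConstSMul G X] [Countable G]
    (ℓ : GeodesicLength G) (μ : Measure X) [IsProbabilityMeasure μ] [SMulInvariantMeasure G X μ]
    (hfree : ∀ᵐ x ∂μ, ∀ g : G, g • x = x → g = 1)
    (hgrowth : ∀ c : ℝ≥0∞, c ≠ 0 →
      ∃ ρ : ℕ, ((4 * (2 * ρ + 1) : ℕ) : ℝ≥0∞) / (ℓ.ball ρ).card ≤ c)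
    (hFol : ∀ R q : ℕ, ∃ F : Finset G, F.Nonempty ∧ q * ((ℓ.ball R * F) \ F).card ≤ F.card)
    {c : ℝ≥0∞} (hc : c ≠ 0) :
    ∃ κ : ℝ≥0∞, κ ≠ 0 ∧ ∀ V : Set X, MeasurableSet V → ∀ (R : ℕ) (δ : ℝ≥0∞), δ ≠ 0 →
      ∃ (V' : Set X) (A : G → Set X) (L : ℕ), MeasurableSet V' ∧ V' ⊆ V ∧ μ V' ≤ δ ∧
        (∀ g, MeasurableSet (A g)) ∧ (∀ g, A g ⊆ V) ∧ (∀ g, A g⁻¹ = (g⁻¹ • ·) ⁻¹' A g) ∧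
        (μ V ≤ κ → ∑' g, (ℓ.len g : ℝ≥0∞) * μ (A g) ≤ c) ∧
        (∀ x ∈ V, ∃ h, ℓ.len h ≤ L ∧ h • x ∈ V' ∧ GraphingJoined A x (h • x)) ∧
        μ {x | ¬ ∀ g ∈ ℓ.ball R, ∀ h ∈ ℓ.ball R, g • x ∈ V → h • x ∈ V →
          GraphingJoined A (g • x) (h • x)} ≤ δ := by
  have hc3 : c / 3 ≠ 0 := by simp [hc]
  obtain ⟨ρ, hρ⟩ := hgrowth (c / 3) hc3
  set a : ℕ := 4 * (2 * ρ + 1) with ha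
  refine ⟨c / 3 / (8 * ρ + 1 : ℕ), ENNReal.div_ne_zero.2 ⟨hc3, ENNReal.natCast_ne_top _⟩, ?_⟩
  intro V hV R₀ δ hδ
  have hδ2 : δ / 2 ≠ 0 := by simp [hδ]
  obtain ⟨R₁, hR₁⟩ := hgrowth (δ / 2) hδ2
  set R := max (max ρ R₀) R₁ with hR
  have hρR : ρ ≤ R := by omega
  have hR0R : R₀ ≤ R := by omega
  have hbR : ((ℓ.ball R).card : ℝ≥0∞)⁻¹ ≤ δ / 2 := by
    refine le_trans ?_ hR₁
    rw [div_eq_mul_inv]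
    have h1 : ((ℓ.ball R).card : ℝ≥0∞)⁻¹ ≤ ((ℓ.ball R₁).card : ℝ≥0∞)⁻¹ := by
      rw [ENNReal.inv_le_inv]
      exact_mod_cast Finset.card_le_card (ℓ.ball_mono (by omega))
    refine h1.trans ?_
    refine le_mul_of_one_le_left' ?_
    exact_mod_cast (by omega : 1 ≤ 4 * (2 * R₁ + 1))
  obtain ⟨η, hη0, hη1, hη2⟩ : ∃ η : ℝ≥0∞, η ≠ 0 ∧ η ≤ δ / 2 ∧ a * η ≤ c / 3 := by
    refine ⟨min (δ / 2) (c / 3 / a), ?_, min_le_left _ _, ?_⟩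
    · refine (lt_min (pos_iff_ne_zero.2 hδ2) (pos_iff_ne_zero.2 ?_)).ne'
      exact ENNReal.div_ne_zero.2 ⟨hc3, ENNReal.natCast_ne_top _⟩
    · refine (mul_le_mul_right (min_le_right _ _) _).trans ?_
      exact ENNReal.mul_div_le
  obtain ⟨𝒯₀, F, hF, hcov, hfr⟩ := exists_tiling μ hfree (K := ℓ.ball R)
    (fun k hk => ℓ.inv_mem_ball hk) (hFol R) hη0
  obtain ⟨𝒯, hshape, htrace, hregion⟩ := 𝒯₀.exists_refinement hV
  choose E Z m hEsymm hEW hZW hcost hm hZcard hrep hjoin using fun j : (ℕ × Finset G) × Finset G =>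
    ℓ.exists_forest hρR (𝒯.shape j) (j.2 ∩ 𝒯.shape j) Finset.inter_subset_right
  have hcov' : μ (𝒯.region 𝒯.shape)ᶜ = 0 := by
    have : 𝒯.region 𝒯.shape = 𝒯₀.region 𝒯₀.shape := by
      rw [← hregion]; congr 1; funext j; exact hshape j
    rw [this, hcov]
  have hfr' : ∑' j, (((ℓ.ball R).frontierBy (𝒯.shape j)).card : ℝ≥0∞) * μ (𝒯.base j) ≤ η := by
    rw [← 𝒯.measure_region μ fun j => Finset.frontierBy_subset _ _]
    refine le_trans (le_of_eq ?_) hfr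
    rw [← hregion]; congr 2; funext j; rw [hshape]
  have htot : ∑' j, ((𝒯.shape j).card : ℝ≥0∞) * μ (𝒯.base j) ≤ 1 := by
    rw [← 𝒯.measure_region μ fun _ => subset_rfl]
    exact prob_le_one
  have hmemV : ∀ {j d y}, y ∈ 𝒯.base j → d ∈ 𝒯.shape j → (d • y ∈ V ↔ d ∈ j.2 ∩ 𝒯.shape j) := by
    intro j d y hy hd
    rw [htrace j y hy d (hshape j ▸ hd), Finset.mem_inter]
    exact ⟨fun h => ⟨h, hd⟩, fun h => h.1⟩
  have hWV : ∀ {j d y}, y ∈ 𝒯.base j → d ∈ j.2 ∩ 𝒯.shape j → d • y ∈ V := fun hy hd =>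
    (hmemV hy (Finset.mem_inter.1 hd).2).2 hd
  have hVsum : ∑' j, ((j.2 ∩ 𝒯.shape j).card : ℝ≥0∞) * μ (𝒯.base j) ≤ μ V := by
    rw [← 𝒯.measure_region μ fun j => Finset.inter_subset_right]
    refine measure_mono fun z hz => ?_
    rw [𝒯.mem_region] at hz
    obtain ⟨j, g, hg, y, hy, rfl⟩ := hz
    exact hWV hy hg
  have hpack : ∀ (b : ℕ) (n : (ℕ × Finset G) × Finset G → ℕ), b ≠ 0 →
      (∀ j, b * n j ≤ b * ((ℓ.ball R).frontierBy (𝒯.shape j)).card + (𝒯.shape j).card) →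
      ∑' j, (n j : ℝ≥0∞) * μ (𝒯.base j) ≤ η + (b : ℝ≥0∞)⁻¹ := by
    intro b n hb hn
    have h1 : ∀ j, (n j : ℝ≥0∞) * μ (𝒯.base j) ≤
        (((ℓ.ball R).frontierBy (𝒯.shape j)).card : ℝ≥0∞) * μ (𝒯.base j) +
          (b : ℝ≥0∞)⁻¹ * (((𝒯.shape j).card : ℝ≥0∞) * μ (𝒯.base j)) := by
      intro j
      rw [← mul_assoc, ← add_mul]
      gcongr
      have h2 : (b : ℝ≥0∞) * n j ≤ b * ((ℓ.ball R).frontierBy (𝒯.shape j)).card +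
          (𝒯.shape j).card := by exact_mod_cast hn j
      have hb0 : (b : ℝ≥0∞) ≠ 0 := by exact_mod_cast hb
      have hbt : (b : ℝ≥0∞) ≠ ∞ := ENNReal.natCast_ne_top b
      have h3 := mul_le_mul_right h2 (b : ℝ≥0∞)⁻¹
      rwa [mul_add, ← mul_assoc, ← mul_assoc, ENNReal.inv_mul_cancel hb0 hbt, one_mul,
        one_mul] at h3
    refine (ENNReal.tsum_le_tsum h1).trans ?_
    rw [ENNReal.tsum_add, ENNReal.tsum_mul_left]
    exact add_le_add hfr' (mul_le_of_le_one_right' htot)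
  have hball0 : ∀ n, (ℓ.ball n).card ≠ 0 := fun n =>
    (Finset.card_pos.2 ⟨1, ℓ.one_mem_ball n⟩).ne'
  set A : G → Set X := fun g => ⋃ j, ⋃ e ∈ (E j).filter (fun e => e.2 * e.1⁻¹ = g),
    e.1 • 𝒯.base j with hA
  have hmemA : ∀ {g x}, x ∈ A g ↔ ∃ j, ∃ e ∈ E j, e.2 * e.1⁻¹ = g ∧
      ∃ y ∈ 𝒯.base j, e.1 • y = x := by
    intro g x
    simp only [hA, Set.mem_iUnion, Finset.mem_filter, Set.mem_smul_set, exists_prop, and_assoc]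
  have hlift : ∀ {j y p q}, y ∈ 𝒯.base j →
      Relation.ReflTransGen (fun a b => (a, b) ∈ E j) p q → GraphingJoined A (p • y) (q • y) := by
    intro j y p q hy hpq
    refine Relation.ReflTransGen.lift (fun g => g • y) ?_ _ _ hpq
    intro u v huv
    exact ⟨v * u⁻¹, hmemA.2 ⟨j, (u, v), huv, rfl, y, hy, rfl⟩, by
      rw [← mul_smul, inv_mul_cancel_right]⟩
  refine ⟨𝒯.region Z ∪ (V \ 𝒯.region 𝒯.shape), A,
    (F ×ˢ F).sup fun e => ℓ.gap e.1 e.2, ?_, ?_, ?_, ?_, ?_, ?_, ?_, ?_, ?_⟩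
  · exact (𝒯.measurableSet_region _).union (hV.diff (𝒯.measurableSet_region _))
  · refine Set.union_subset (fun z hz => ?_) Set.sdiff_subset
    rw [𝒯.mem_region] at hz
    obtain ⟨j, g, hg, y, hy, rfl⟩ := hz
    exact hWV hy (hZW j hg)
  · refine (measure_union_le _ _).trans ?_
    have h1 : μ (V \ 𝒯.region 𝒯.shape) = 0 :=
      measure_mono_null (fun x hx => hx.2) hcov'
    rw [h1, add_zero]
    refine (𝒯.measure_region_le μ _).trans ((hpack _ _ (hball0 R) hZcard).trans ?_)
    exact (add_le_add hη1 hbR).trans (ENNReal.add_halves δ).le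
  · intro g
    exact MeasurableSet.iUnion fun j => Finset.measurableSet_biUnion _ fun e _ =>
      (𝒯.measurableSet_base j).const_smul e.1
  · intro g x hx
    obtain ⟨j, e, he, -, y, hy, rfl⟩ := hmemA.1 hx
    exact hWV hy (hEW j e he).1
  · intro g
    ext x
    rw [Set.mem_preimage, hmemA, hmemA]
    constructor
    · rintro ⟨j, e, he, heg, y, hy, rfl⟩
      refine ⟨j, (e.2, e.1), hEsymm j _ _ he, ?_, y, hy, ?_⟩
      · rw [← inv_inj, ← heg]; simp
      · rw [← heg, ← mul_smul, inv_mul_cancel_right]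
    · rintro ⟨j, e, he, heg, y, hy, hx⟩
      refine ⟨j, (e.2, e.1), hEsymm j _ _ he, ?_, y, hy, ?_⟩
      · rw [← heg]; simp
      · rw [eq_inv_smul_iff, ← mul_smul, ← heg, inv_mul_cancel_right] at hx
        exact hx
  · intro hVκ
    have h1 : ∀ g, (ℓ.len g : ℝ≥0∞) * μ (A g) ≤ ∑' j, ∑ e ∈ E j,
        if e.2 * e.1⁻¹ = g then (ℓ.len g : ℝ≥0∞) * μ (𝒯.base j) else 0 := by
      intro g
      have h2 : μ (A g) ≤ ∑' j, ∑ e ∈ (E j).filter (fun e => e.2 * e.1⁻¹ = g), μ (𝒯.base j) := by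
        refine (measure_iUnion_le _).trans (ENNReal.tsum_le_tsum fun j => ?_)
        refine (measure_biUnion_finset_le _ _).trans ?_
        simp [measure_smul]
      refine (mul_le_mul_right h2 _).trans ?_
      rw [← ENNReal.tsum_mul_left]
      refine ENNReal.tsum_le_tsum fun j => ?_
      rw [Finset.mul_sum, Finset.sum_filter]
    have h3 : ∀ j, ∑' g, ∑ e ∈ E j,
        (if e.2 * e.1⁻¹ = g then (ℓ.len g : ℝ≥0∞) * μ (𝒯.base j) else 0) ≤
        a * ((m j : ℝ≥0∞) * μ (𝒯.base j)) +
          (8 * ρ : ℕ) * (((j.2 ∩ 𝒯.shape j).card : ℝ≥0∞) * μ (𝒯.base j)) := by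
      intro j
      rw [Summable.tsum_finsetSum fun _ _ => ENNReal.summable]
      have h4 : ∀ e : G × G, ∑' g, (if e.2 * e.1⁻¹ = g then (ℓ.len g : ℝ≥0∞) * μ (𝒯.base j)
          else 0) = (ℓ.gap e.1 e.2 : ℝ≥0∞) * μ (𝒯.base j) := by
        intro e
        rw [tsum_eq_single (e.2 * e.1⁻¹) fun g hg => if_neg (Ne.symm hg), if_pos rfl]
        rfl
      simp_rw [h4]
      rw [← Finset.sum_mul, ← mul_assoc, ← mul_assoc, ← add_mul]
      gcongr
      exact_mod_cast hcost j
    refine (ENNReal.tsum_le_tsum h1).trans ?_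
    rw [ENNReal.tsum_comm]
    refine (ENNReal.tsum_le_tsum h3).trans ?_
    rw [ENNReal.tsum_add, ENNReal.tsum_mul_left, ENNReal.tsum_mul_left]
    have h5 := hpack _ _ (hball0 ρ) hm
    calc _ ≤ (a : ℝ≥0∞) * (η + ((ℓ.ball ρ).card : ℝ≥0∞)⁻¹) +
          (8 * ρ + 1 : ℕ) * (c / 3 / (8 * ρ + 1 : ℕ)) := by
          refine add_le_add (mul_le_mul_right h5 _) ?_
          refine mul_le_mul' ?_ (hVsum.trans hVκ)
          exact_mod_cast Nat.le_succ _
      _ ≤ c / 3 + c / 3 + c / 3 := by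
          refine add_le_add ?_ ENNReal.mul_div_le
          rw [mul_add, ← div_eq_mul_inv]
          exact add_le_add hη2 hρ
      _ = c := ENNReal.add_thirds c
  · intro x hx
    by_cases hxr : x ∈ 𝒯.region 𝒯.shape
    · obtain ⟨j, d, hd, y, hy, rfl⟩ := 𝒯.mem_region.1 hxr
      obtain ⟨z, hz, hdz⟩ := hrep j d ((hmemV hy hd).1 hx)
      have heq : (z * d⁻¹) • d • y = z • y := by rw [← mul_smul, inv_mul_cancel_right]
      refine ⟨z * d⁻¹, ?_, ?_, ?_⟩
      · have hzs : z ∈ 𝒯.shape j := (Finset.mem_inter.1 (hZW j hz)).2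
        rw [hshape] at hd hzs
        exact Finset.le_sup (f := fun e : G × G => ℓ.gap e.1 e.2) (b := (d, z))
          (Finset.mem_product.2 ⟨hF _ hd, hF _ hzs⟩)
      · rw [heq]
        exact Or.inl (𝒯.mem_region.2 ⟨j, z, hz, y, hy, rfl⟩)
      · rw [heq]
        exact hlift hy hdz
    · exact ⟨1, by simp [ℓ.len_one], by rw [one_smul]; exact Or.inr ⟨hx, hxr⟩, by
        rw [one_smul]; exact .refl⟩
  · have hsub : {x | ¬ ∀ g ∈ ℓ.ball R₀, ∀ h ∈ ℓ.ball R₀, g • x ∈ V → h • x ∈ V →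
        GraphingJoined A (g • x) (h • x)} ⊆
        (𝒯.region fun j => (ℓ.ball R).frontierBy (𝒯.shape j)) ∪ (𝒯.region 𝒯.shape)ᶜ := by
      intro x hx
      by_contra hcon
      rw [Set.mem_union, not_or, Set.mem_compl_iff, not_not] at hcon
      obtain ⟨hxf, hxr⟩ := hcon
      refine hx fun g hg h hh hgV hhV => ?_
      obtain ⟨j, d, hd, y, hy, rfl⟩ := 𝒯.mem_region.1 hxr
      have hint : ∀ k ∈ ℓ.ball R, k * d ∈ 𝒯.shape j := by
        by_contra hk
        exact hxf (𝒯.mem_region.2 ⟨j, d, Finset.mem_filter.2 ⟨hd, hk⟩, y, hy, rfl⟩)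
      have hg' := ℓ.ball_mono hR0R hg
      have hh' := ℓ.ball_mono hR0R hh
      rw [← mul_smul] at hgV hhV ⊢
      rw [← mul_smul]
      exact hlift hy (hjoin j d hd hint g hg' h hh' ((hmemV hy (hint g hg')).1 hgV)
        ((hmemV hy (hint h hh')).1 hhV))
    refine (measure_mono hsub).trans ((measure_union_le _ _).trans ?_)
    rw [hcov', add_zero, 𝒯.measure_region μ fun j => Finset.frontierBy_subset _ _]
    exact hfr'.trans (hη1.trans ENNReal.half_le_self)

end Tilings

section Construction

open scoped Classical

variable {G X : Type*} [Group G] [MeasurableSpace X] [MulAction G X]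

omit [MeasurableSpace X] in
lemma GraphingJoined.exists_list {A : G → Set X} {x y : X} (hxy : GraphingJoined A x y) :
    ∃ l : List G, l.prod • x = y ∧
      ∀ i : Fin l.length, (l.drop ((i : ℕ) + 1)).prod • x ∈ A (l.get i) := by
  induction hxy with
  | refl => exact ⟨[], by simp, fun i => i.elim0⟩
  | tail _ h ih =>
    obtain ⟨g, hg, rfl⟩ := h
    obtain ⟨l, rfl, hl⟩ := ih
    refine ⟨g :: l, by rw [List.prod_cons, mul_smul], fun i => ?_⟩
    induction i using Fin.cases with
    | zero => simpa using hg
    | succ i => simpa using hl i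

/-- A graphing of small cost on a small subset of `U`, joining almost all points of the subset
which lie in the same orbit. -/
theorem exists_connected_graphing [StandardBorelSpace X] [MeasurableConstSMul G X] [Countable G]
    (ℓ : GeodesicLength G) (μ : Measure X) [IsProbabilityMeasure μ] [SMulInvariantMeasure G X μ]
    (hfree : ∀ᵐ x ∂μ, ∀ g : G, g • x = x → g = 1)
    (hgrowth : ∀ c : ℝ≥0∞, c ≠ 0 →
      ∃ ρ : ℕ, ((4 * (2 * ρ + 1) : ℕ) : ℝ≥0∞) / (ℓ.ball ρ).card ≤ c)
    (hFol : ∀ R q : ℕ, ∃ F : Finset G, F.Nonempty ∧ q * ((ℓ.ball R * F) \ F).card ≤ F.card)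
    {U : Set X} (hU : MeasurableSet U) (hμU : μ U ≠ 0) {ε : ℝ≥0∞} (hε : ε ≠ 0) (hε' : ε ≠ ∞) :
    ∃ A : G → Set X, (∀ g, MeasurableSet (A g)) ∧ (∀ g, A g⁻¹ = (g⁻¹ • ·) ⁻¹' A g) ∧
      (∀ g, A g ⊆ A 1) ∧ A 1 ⊆ U ∧ μ (A 1) ≠ 0 ∧ μ (A 1) < ε ∧
      ∑' g, (ℓ.len g : ℝ≥0∞) * μ (A g) < ε ∧
      ∀ᵐ x ∂μ, x ∈ A 1 → ∀ g : G, g • x ∈ A 1 → GraphingJoined A x (g • x) := by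
  obtain ⟨c, hc0, hc⟩ := ENNReal.exists_pos_sum_of_countable' hε ℕ
  choose κ hκ hthin using fun n : ℕ =>
    exists_thinning ℓ μ hfree hgrowth hFol (hc0 n).ne'
  obtain ⟨w, hw0, hw⟩ := ENNReal.exists_pos_sum_of_countable' one_ne_zero ℕ
  choose V' B M hV'meas hV'sub hV'le hBmeas hBsub hBsymm hBcost hBrep hBjoin using
    fun (n : ℕ) (V : {V : Set X // MeasurableSet V}) (R : ℕ) =>
      hthin n V.1 V.2 R (min (κ (n + 1)) (w n)) (lt_min (pos_iff_ne_zero.2 (hκ _)) (hw0 n)).ne'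
  obtain ⟨V₀, _, _, hV₀, hV₀U, hV₀le, _, _, _, _, hV₀rep, _⟩ :=
    hthin 0 U hU 0 (min (κ 0) (ε / 2))
      (lt_min (pos_iff_ne_zero.2 (hκ 0)) (ENNReal.half_pos hε)).ne'
  have hμV₀ : μ V₀ ≠ 0 := by
    intro h0
    refine hμU (measure_mono_null (t := ⋃ g : G, g⁻¹ • V₀) (fun x hx => ?_) ?_)
    · obtain ⟨h, -, hh, -⟩ := hV₀rep x hx
      exact Set.mem_iUnion.2 ⟨h, Set.mem_inv_smul_set_iff.2 hh⟩
    · exact measure_iUnion_null fun g => by rw [measure_smul, h0]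
  let st : ℕ → {V : Set X // MeasurableSet V} × ℕ := fun n => n.rec (⟨V₀, hV₀⟩, 0)
    fun k p => (⟨V' k p.1 (p.2 + k), hV'meas k p.1 (p.2 + k)⟩, p.2 + M k p.1 (p.2 + k))
  set V : ℕ → Set X := fun n => (st n).1.1 with hV
  set L : ℕ → ℕ := fun n => (st n).2 with hL
  set C : ℕ → G → Set X := fun n => B n (st n).1 (L n + n) with hC
  have hVle : ∀ n, μ (V n) ≤ κ n := by
    intro n
    cases n with
    | zero => exact hV₀le.trans (min_le_left _ _)
    | succ n => exact (hV'le n (st n).1 (L n + n)).trans (min_le_left _ _)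
  have hVsucc : ∀ n, V (n + 1) ⊆ V n := fun n => hV'sub n (st n).1 (L n + n)
  have hVsub : ∀ n, V n ⊆ V₀ := by
    intro n
    induction n with
    | zero => exact subset_rfl
    | succ n ih => exact (hVsucc n).trans ih
  set A : G → Set X := fun g => (if g = 1 then V₀ else ∅) ∪ ⋃ n, C n g with hA
  have hCA : ∀ n g, C n g ⊆ A g := fun n g =>
    (Set.subset_iUnion (fun n => C n g) n).trans Set.subset_union_right
  have hAV : ∀ g, A g ⊆ V₀ := by
    intro g
    refine Set.union_subset ?_ (Set.iUnion_subset fun n => (hBsub n _ _ g).trans (hVsub n))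
    split_ifs
    · exact subset_rfl
    · exact Set.empty_subset _
  have hA1 : A 1 = V₀ := (hAV 1).antisymm (by simp [hA])
  have hAsymm : ∀ g, A g⁻¹ = (g⁻¹ • ·) ⁻¹' A g := by
    intro g
    simp only [hA, Set.preimage_union, Set.preimage_iUnion]
    congr 1
    · by_cases hg : g = 1 <;> simp [hg]
    · exact Set.iUnion_congr fun n => hBsymm n _ _ g
  have hrep : ∀ n, ∀ x ∈ V₀, ∃ h, ℓ.len h ≤ L n ∧ h • x ∈ V n ∧ GraphingJoined A x (h • x) := by
    intro n x hx
    induction n with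
    | zero =>
      exact ⟨1, by simp [ℓ.len_one], by rw [one_smul]; exact hx, by rw [one_smul]; exact .refl⟩
    | succ n ih =>
      obtain ⟨h, hh, hhV, hhj⟩ := ih
      obtain ⟨k, hk, hkV, hkj⟩ := hBrep n (st n).1 (L n + n) _ hhV
      rw [← mul_smul] at hkV hkj
      refine ⟨k * h, ?_, hkV, hhj.trans (hkj.mono (hCA n))⟩
      have h1 := ℓ.len_mul_le k h
      have h2 : L (n + 1) = L n + M n (st n).1 (L n + n) := rfl
      omega
  have hgood := ae_eventually_notMem (μ := μ)
    (s := fun n => {x | ¬ ∀ g ∈ ℓ.ball (L n + n), ∀ h ∈ ℓ.ball (L n + n), g • x ∈ V n →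
      h • x ∈ V n → GraphingJoined (C n) (g • x) (h • x)})
    (ne_top_of_le_ne_top (hw.trans ENNReal.one_lt_top).ne (ENNReal.tsum_le_tsum fun n =>
      (hBjoin n (st n).1 (L n + n)).trans (min_le_right _ _)))
  refine ⟨A, fun g => ?_, hAsymm, fun g => hA1 ▸ hAV g, hA1 ▸ hV₀U, hA1 ▸ hμV₀, ?_, ?_, ?_⟩
  · refine MeasurableSet.union ?_ (MeasurableSet.iUnion fun n => hBmeas n _ _ g)
    split_ifs
    · exact hV₀
    · exact .empty
  · rw [hA1]
    exact hV₀le.trans_lt ((min_le_right _ _).trans_lt (ENNReal.half_lt_self hε hε'))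
  · refine lt_of_le_of_lt ?_ hc
    calc ∑' g, (ℓ.len g : ℝ≥0∞) * μ (A g)
        ≤ ∑' g, ∑' n, (ℓ.len g : ℝ≥0∞) * μ (C n g) := by
          refine ENNReal.tsum_le_tsum fun g => ?_
          rw [ENNReal.tsum_mul_left]
          by_cases hg : g = 1
          · simp [hg, ℓ.len_one]
          · refine mul_le_mul_right ?_ _
            simp only [hA, if_neg hg, Set.empty_union]
            exact measure_iUnion_le _
      _ = ∑' n, ∑' g, (ℓ.len g : ℝ≥0∞) * μ (C n g) := ENNReal.tsum_comm
      _ ≤ ∑' n, c n := ENNReal.tsum_le_tsum fun n => hBcost n _ _ (hVle n)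
  · filter_upwards [hgood] with x hx hxA g hgA
    rw [hA1] at hxA hgA
    obtain ⟨n, hn, hng⟩ := (hx.and (eventually_ge_atTop (ℓ.len g))).exists
    rw [not_not] at hn
    obtain ⟨h, hh, hhV, hhj⟩ := hrep n x hxA
    obtain ⟨k, hk, hkV, hkj⟩ := hrep n _ hgA
    have hkg := ℓ.len_mul_le k g
    have hmid := hn h (by rw [ℓ.mem_ball]; omega) (k * g) (by rw [ℓ.mem_ball]; omega) hhV
      (by rwa [mul_smul])
    rw [mul_smul] at hmid
    exact (hhj.trans (hmid.mono (hCA n))).trans (hkj.symm hAsymm)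

end Construction

section WordLength

variable {G : Type*} [Group G] {S : Set G}

lemma wordLength_le {l : List G} (hl : ∀ s ∈ l, s ∈ S) : wordLength S l.prod ≤ l.length :=
  Nat.sInf_le ⟨l, rfl, hl, rfl⟩

lemma wordLength_one : wordLength S (1 : G) = 0 :=
  Nat.le_zero.1 (wordLength_le (S := S) (l := []) (by simp))

variable (hSsym : ∀ s ∈ S, s⁻¹ ∈ S) (hSgen : Subgroup.closure S = ⊤)

include hSsym hSgen in
lemma exists_list_length_eq_wordLength (g : G) :
    ∃ l : List G, l.length = wordLength S g ∧ (∀ s ∈ l, s ∈ S) ∧ l.prod = g := by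
  refine Nat.sInf_mem (s := {n | ∃ l : List G, l.length = n ∧ (∀ s ∈ l, s ∈ S) ∧ l.prod = g}) ?_
  have hSS : S ∪ S⁻¹ = S := Set.union_eq_left.2 fun s hs => by simpa using hSsym _ hs
  have hg : g ∈ (Subgroup.closure S).toSubmonoid := by simp [hSgen]
  rw [Subgroup.closure_toSubmonoid, hSS] at hg
  obtain ⟨l, hl, rfl⟩ := Submonoid.exists_list_of_mem_closure hg
  exact ⟨l.length, l, rfl, hl, rfl⟩

include hSsym hSgen in
lemma wordLength_mul_le (g h : G) : wordLength S (g * h) ≤ wordLength S g + wordLength S h := by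
  obtain ⟨l, hl, hlS, rfl⟩ := exists_list_length_eq_wordLength hSsym hSgen g
  obtain ⟨m, hm, hmS, rfl⟩ := exists_list_length_eq_wordLength hSsym hSgen h
  rw [← hl, ← hm, ← List.prod_append, ← List.length_append]
  exact wordLength_le fun s hs => (List.mem_append.1 hs).elim (hlS s) (hmS s)

include hSsym hSgen in
lemma wordLength_inv_le (g : G) : wordLength S g⁻¹ ≤ wordLength S g := by
  obtain ⟨l, hl, hlS, rfl⟩ := exists_list_length_eq_wordLength hSsym hSgen g
  rw [← hl, List.prod_inv_reverse]
  refine (wordLength_le fun s hs => ?_).trans (by simp)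
  obtain ⟨t, ht, rfl⟩ := List.mem_map.1 (List.mem_reverse.1 hs)
  exact hSsym t (hlS t ht)

include hSsym hSgen in
lemma exists_of_wordLength_eq_succ {n : ℕ} {g : G} (hg : wordLength S g = n + 1) :
    ∃ s h, s ∈ S ∧ wordLength S h = n ∧ g = s * h := by
  obtain ⟨l, hl, hlS, rfl⟩ := exists_list_length_eq_wordLength hSsym hSgen g
  cases l with
  | nil => exact absurd (hl.trans hg) (Nat.succ_ne_zero n).symm
  | cons s l =>
    have hl' : wordLength S l.prod ≤ l.length :=
      wordLength_le fun t ht => hlS t (List.mem_cons_of_mem _ ht)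
    have hs : wordLength S s ≤ 1 := by
      simpa using wordLength_le (S := S) (l := [s]) (by simpa using hlS s)
    have h := wordLength_mul_le hSsym hSgen s l.prod
    rw [List.prod_cons] at hg
    rw [List.length_cons, List.prod_cons] at hl
    exact ⟨s, l.prod, hlS s (by simp), by omega, List.prod_cons⟩

include hSsym hSgen in
lemma finite_wordLength_le (hS : S.Finite) (n : ℕ) : {g | wordLength S g ≤ n}.Finite := by
  induction n with
  | zero =>
    refine (Set.finite_singleton (1 : G)).subset fun g hg => ?_
    obtain ⟨l, hl, -, rfl⟩ := exists_list_length_eq_wordLength hSsym hSgen g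
    rw [List.length_eq_zero_iff.1 (hl.trans (Nat.le_zero.1 hg))]
    simp
  | succ n ih =>
    refine (ih.union (hS.mul ih)).subset fun g hg => ?_
    rcases Nat.le_succ_iff.1 hg with h | h
    · exact Or.inl h
    · obtain ⟨s, k, hs, hk, rfl⟩ := exists_of_wordLength_eq_succ hSsym hSgen h
      exact Or.inr (Set.mul_mem_mul hs hk.le)

/-- The word length of a finite symmetric generating set. -/
noncomputable def GeodesicLength.ofGenerators (hS : S.Finite) (hSsym : ∀ s ∈ S, s⁻¹ ∈ S)
    (hSgen : Subgroup.closure S = ⊤) : GeodesicLength G where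
  len := wordLength S
  len_one := wordLength_one
  len_mul_le := wordLength_mul_le hSsym hSgen
  len_inv g := (wordLength_inv_le hSsym hSgen g).antisymm (by
    simpa using wordLength_inv_le hSsym hSgen g⁻¹)
  exists_of_len_succ n g hg := by
    obtain ⟨s, h, hs, hh, hgs⟩ := exists_of_wordLength_eq_succ hSsym hSgen hg
    exact ⟨s, h, by simpa using wordLength_le (S := S) (l := [s]) (by simpa using hs), hh, hgs⟩
  finite_len_le := finite_wordLength_le hSsym hSgen hS

lemma wordBall_natCast (hS : S.Finite) (hSsym : ∀ s ∈ S, s⁻¹ ∈ S)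
    (hSgen : Subgroup.closure S = ⊤) (n : ℕ) :
    wordBall S n = (GeodesicLength.ofGenerators hS hSsym hSgen).ball n := by
  ext g
  rw [Finset.mem_coe, GeodesicLength.mem_ball]
  exact Nat.cast_le (α := ℝ)

end WordLength

namespace GeodesicLength

open scoped Classical

variable {G : Type*} [Group G] (ℓ : GeodesicLength G)

include ℓ in
lemma countable : Countable G := by
  rw [← Set.countable_univ_iff]
  refine (Set.countable_iUnion fun n => (ℓ.finite_len_le n).countable).mono fun g _ =>
    Set.mem_iUnion.2 ⟨ℓ.len g, le_refl (ℓ.len g)⟩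

lemma exists_div_card_ball_le
    (h : Tendsto (fun n : ℕ => ((ℓ.ball n).card : ℝ) / n) atTop atTop) {c : ℝ≥0∞} (hc : c ≠ 0) :
    ∃ ρ : ℕ, ((4 * (2 * ρ + 1) : ℕ) : ℝ≥0∞) / (ℓ.ball ρ).card ≤ c := by
  obtain ⟨N, hN⟩ := ENNReal.exists_nat_mul_gt hc (ENNReal.natCast_ne_top 12)
  obtain ⟨ρ, hρ, hρ1⟩ := ((h.eventually_ge_atTop (N : ℝ)).and (eventually_ge_atTop 1)).exists
  refine ⟨ρ, ENNReal.div_le_of_le_mul' ?_⟩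
  rw [le_div_iff₀ (by exact_mod_cast hρ1)] at hρ
  have h1 : N * ρ ≤ (ℓ.ball ρ).card := by exact_mod_cast hρ
  calc ((4 * (2 * ρ + 1) : ℕ) : ℝ≥0∞) ≤ (ρ * 12 : ℕ) := by exact_mod_cast (by omega)
    _ = ρ * (12 : ℕ) := by push_cast; rfl
    _ ≤ ρ * (N * c) := by gcongr
    _ = (N * ρ : ℕ) * c := by push_cast; ring
    _ ≤ (ℓ.ball ρ).card * c := by gcongr

end GeodesicLength

section Folner

open scoped Classical

variable {G : Type*} [Group G] {S : Set G}

lemma exists_folner_finset (hS : S.Finite) (hSsym : ∀ s ∈ S, s⁻¹ ∈ S)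
    (hSgen : Subgroup.closure S = ⊤)
    (hamen : ∀ ε > (0 : ℝ), ∀ r > (0 : ℝ), ∃ F : Set G, F.Finite ∧ F.Nonempty ∧
      (((wordBall S r * F) \ F).ncard : ℝ) ≤ ε * (F.ncard : ℝ)) (R q : ℕ) :
    ∃ F : Finset G, F.Nonempty ∧
      q * (((GeodesicLength.ofGenerators hS hSsym hSgen).ball R * F) \ F).card ≤ F.card := by
  set ℓ := GeodesicLength.ofGenerators hS hSsym hSgen
  obtain ⟨F, hF, hne, hcard⟩ := hamen (1 / (q + 1)) (by positivity) ((R + 1 : ℕ) : ℝ)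
    (by positivity)
  lift F to Finset G using hF
  refine ⟨F, by exact_mod_cast hne, ?_⟩
  rw [wordBall_natCast hS hSsym hSgen, ← Finset.coe_mul, ← Finset.coe_sdiff,
    Set.ncard_coe_finset, Set.ncard_coe_finset, one_div, inv_mul_eq_div,
    le_div_iff₀ (by positivity)] at hcard
  have h1 : ((ℓ.ball (R + 1) * F) \ F).card * (q + 1) ≤ F.card := by exact_mod_cast hcard
  have h2 : ((ℓ.ball R * F) \ F).card ≤ ((ℓ.ball (R + 1) * F) \ F).card :=
    Finset.card_le_card (Finset.sdiff_subset_sdiff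
      (Finset.mul_subset_mul_right (ℓ.ball_mono (Nat.le_succ R))) subset_rfl)
  nlinarith

end Folner

theorem stmt17 {G X : Type*} [Group G] [MeasurableSpace X] [StandardBorelSpace X]
    (S : Set G) (hSfin : S.Finite) (hSsym : ∀ s ∈ S, s⁻¹ ∈ S)
    (hSgen : Subgroup.closure S = ⊤)
    -- super-linear growth
    (hgrowth : Tendsto (fun n : ℕ => (((wordBall S n).ncard : ℝ) / (n : ℝ))) atTop atTop)
    -- amenability: (ε,r)-Følner sets exist for all ε, r > 0
    (hamen : ∀ ε > (0 : ℝ), ∀ r > (0 : ℝ), ∃ F : Set G, F.Finite ∧ F.Nonempty ∧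
      (((wordBall S r * F) \ F).ncard : ℝ) ≤ ε * (F.ncard : ℝ))
    -- a free ergodic G-system (X, μ, T)
    (μ : Measure X) [IsProbabilityMeasure μ]
    (T : G → X → X) (hT1 : T 1 = id) (hTmul : ∀ g k : G, T (g * k) = T g ∘ T k)
    (hTmp : ∀ g : G, MeasurePreserving (T g) μ μ)
    (herg : ∀ A : Set X, MeasurableSet A →
      (∀ g : G, μ (symmDiff (T g ⁻¹' A) A) = 0) → μ A = 0 ∨ μ A = 1)
    (hfree : ∀ᵐ x ∂μ, Function.Injective fun g : G => T g x)
    (U : Set X) (hU : MeasurableSet U) (hUpos : 0 < μ U)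
    {ε : ℝ} (hε : 0 < ε) :
    -- there is a T-graphing Γ = (A_g)_g ...
    ∃ A : G → Set X,
      (∀ g : G, MeasurableSet (A g)) ∧
      -- ... satisfying the symmetry A_{g⁻¹} = T^g A_g ...
      (∀ g : G, A g⁻¹ = T g⁻¹ ⁻¹' (A g)) ∧
      -- ... with vertex set contained in U, nontrivial, of measure < ε ...
      (⋃ g : G, A g) ⊆ U ∧
      0 < μ (⋃ g : G, A g) ∧
      μ (⋃ g : G, A g) < ENNReal.ofReal ε ∧
      -- ... of |·|_G-cost < ε ...
      (∑' g : G, (wordLength S g : ℝ≥0∞) * μ (A g)) < ENNReal.ofReal ε ∧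
      -- ... and orbit-wise connected
      (∃ V₀ : Set X, MeasurableSet V₀ ∧ V₀ ⊆ (⋃ g : G, A g) ∧
        μ ((⋃ g : G, A g) \ V₀) = 0 ∧
        ∀ x ∈ V₀, ∀ g : G, T g x ∈ V₀ →
          ∃ l : List G, l ≠ [] ∧ l.prod = g ∧
            ∀ i : Fin l.length, T ((l.drop ((i : ℕ) + 1)).prod) x ∈ A (l.get i)) := by
  let _ : MulAction G X :=
    { smul := T
      one_smul := fun x => congrFun hT1 x
      mul_smul := fun g k x => congrFun (hTmul g k) x }
  have : MeasurableConstSMul G X := ⟨fun g => (hTmp g).measurable⟩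
  have : SMulInvariantMeasure G X μ :=
    ⟨fun g s hs => (hTmp g).measure_preimage hs.nullMeasurableSet⟩
  have hfree' : ∀ᵐ x ∂μ, ∀ g : G, g • x = x → g = 1 := by
    filter_upwards [hfree] with x hx g hg
    exact hx (show g • x = (1 : G) • x by rw [hg, one_smul])
  set ℓ := GeodesicLength.ofGenerators hSfin hSsym hSgen
  have := ℓ.countable
  obtain ⟨A, hAmeas, hAsymm, hA1, hAU, hpos, hlt, hcost, hconn⟩ :=
    exists_connected_graphing ℓ μ hfree'
      (fun c hc => ℓ.exists_div_card_ball_le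
        (by simpa only [wordBall_natCast hSfin hSsym hSgen, Set.ncard_coe_finset] using hgrowth) hc)
      (exists_folner_finset hSfin hSsym hSgen hamen) hU hUpos.ne'
      (ENNReal.ofReal_pos.2 hε).ne' ENNReal.ofReal_ne_top
  have hvert : ⋃ g, A g = A 1 := (Set.iUnion_subset hA1).antisymm (Set.subset_iUnion A 1)
  refine ⟨A, hAmeas, hAsymm, by rwa [hvert], ?_⟩
  rw [hvert]
  refine ⟨pos_iff_ne_zero.2 hpos, hlt, hcost, ?_⟩
  obtain ⟨Y, hY, hYmeas, hYae⟩ := (hconn.and hfree').exists_measurable_mem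
  refine ⟨A 1 ∩ Y, (hAmeas 1).inter hYmeas, Set.inter_subset_left, ?_, ?_⟩
  · exact measure_mono_null (fun x hx hxY => hx.2 ⟨hx.1, hxY⟩) (mem_ae_iff.1 hY)
  · rintro x ⟨hxA, hxY⟩ g ⟨hgA, -⟩
    obtain ⟨hj, hfx⟩ := hYae x hxY
    obtain ⟨l, hl, hlA⟩ := (hj hxA g hgA).exists_list
    have hlg : l.prod = g := by
      refine inv_mul_eq_one.1 (hfx _ ?_)
      rw [mul_smul, inv_smul_eq_iff, hl]
    rcases eq_or_ne l [] with rfl | hne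
    · refine ⟨[1], by simp, by simpa using hlg, fun i => ?_⟩
      obtain rfl : i = 0 := Subsingleton.elim (α := Fin 1) _ _
      simpa [hT1] using hxA
    · exact ⟨l, hne, hlg, hlA⟩
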